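/- Let p ≥ 5 be a prime with p ≡ 3 (mod 4) and p ≠ 3, let π = √p·ζ₃ in L = ℚ(√p, √(-3)), and let R_sp = ℤ[π, p·π^{-1}, π²/p]. Then R_sp equals the full ring of integers O_L of L. -/

import Mathlib

theorem s12_conv {L : Type} [Field L] {x y : L} (h : IsIntegral ℤ x) (e : y = x) :
    IsIntegral ℤ y := e ▸ h

theorem s12_rat {L : Type} [Field L] [CharZero L] (q : ℚ) (h : IsIntegral ℤ (q : L)) :
    ∃ n : ℤ, q = n := by
  have h2 : IsIntegral ℤ q := by
    have : IsIntegral ℤ (algebraMap ℚ L q) := by simpa using h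
    exact (isIntegral_algebraMap_iff (algebraMap ℚ L).injective).1 this
  obtain ⟨n, hn⟩ := (IsIntegrallyClosed.isIntegral_iff (R := ℤ) (K := ℚ)).1 h2
  exact ⟨n, by simpa using hn.symm⟩

theorem s12_indep {L : Type} [Field L] [CharZero L] (β : L) (hβ : β ^ 2 = -3) (a b : ℚ)
    (h : (a : L) + b * β = 0) : a = 0 ∧ b = 0 := by
  have h1 : (a : L) ^ 2 + 3 * (b : L) ^ 2 = 0 := by
    linear_combination ((a : L) - b * β) * h + (b : L) ^ 2 * hβ
  have h2 : a ^ 2 + 3 * b ^ 2 = 0 := by exact_mod_cast h1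
  constructor <;> nlinarith [sq_nonneg a, sq_nonneg b]

theorem s12_three (q : ℚ) (n : ℤ) (h : 3 * q ^ 2 = n) : ∃ m : ℤ, q = m := by
  have h1 : IsIntegral ℤ (3 * q) := by
    refine IsIntegral.of_pow (n := 2) (by norm_num) ?_
    have : (3 * q) ^ 2 = algebraMap ℤ ℚ (3 * n) := by
      simp; linear_combination 3 * h
    rw [this]; exact isIntegral_algebraMap
  obtain ⟨k, hk⟩ := s12_rat (L := ℚ) (3 * q) (by simpa using h1)
  have h2 : k ^ 2 = 3 * n := by
    have : (k : ℚ) ^ 2 = 3 * n := by rw [← hk]; linear_combination 3 * h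
    exact_mod_cast this
  have h3 : (3 : ℤ) ∣ k := Int.prime_three.dvd_of_dvd_pow ⟨n, h2⟩
  obtain ⟨m, rfl⟩ := h3
  exact ⟨m, by push_cast at hk; linarith⟩

theorem s12_Q {L : Type} [Field L] [CharZero L] (β : L) (hβ : β ^ 2 = -3)
    (τ : L →+* L) (hτ : τ β = -β) (a b : ℚ) (h : IsIntegral ℤ ((a : L) + b * β)) :
    ∃ m n : ℤ, a = m - n / 2 ∧ b = n / 2 := by
  have ht : IsIntegral ℤ (τ ((a : L) + b * β)) := map_isIntegral_int τ h
  have e : τ ((a : L) + b * β) = a - b * β := by simp [hτ]; ring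
  rw [e] at ht
  obtain ⟨A, hA⟩ := s12_rat (L := L) (2 * a) (by
    have := h.add ht
    refine s12_conv this ?_; push_cast; ring)
  obtain ⟨N, hN⟩ := s12_rat (L := L) (a ^ 2 + 3 * b ^ 2) (by
    have := h.mul ht
    refine s12_conv this ?_; push_cast; linear_combination (b : L) ^ 2 * hβ)
  obtain ⟨B, hB⟩ := s12_three (2 * b) (4 * N - A ^ 2) (by
    push_cast; rw [← hN, ← hA]; ring)
  have h4 : A ^ 2 + 3 * B ^ 2 = 4 * N := by
    have : (A : ℚ) ^ 2 + 3 * B ^ 2 = 4 * N := by rw [← hN, ← hA, ← hB]; ring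
    exact_mod_cast this
  have h5 : Even (A + B) := by
    have h6 : Even (A ^ 2 + 3 * B ^ 2) := by rw [h4]; exact ⟨2 * N, by ring⟩
    by_contra h7
    simp only [Int.even_add, Int.even_pow, Int.even_mul] at h6 h7
    revert h6; simp; 
    have : ¬ Even (3 : ℤ) := by decide
    tauto
  obtain ⟨m, hm⟩ := h5
  have hm' : (A : ℚ) + B = m + m := by exact_mod_cast hm
  exact ⟨m, B, by linarith, by linarith⟩

theorem s12_mod4 (p a b c d m n : ℤ) (hp : p % 4 = 3)
    (h1 : a ^ 2 - b ^ 2 - p * (c ^ 2 - d ^ 2) = 4 * m)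
    (h2 : 2 * a * b - b ^ 2 - p * (2 * c * d - d ^ 2) = 4 * n) :
    (2 ∣ a ∧ 2 ∣ b) ∧ (2 ∣ c ∧ 2 ∣ d) := by
  have hp' : (p : ZMod 4) = 3 := by
    have : ((p : ℤ) : ZMod 4) = ((3 : ℤ) : ZMod 4) := (ZMod.intCast_eq_intCast_iff' _ _ 4).2 (by simpa using hp)
    simpa using this
  have k4 : (4 : ZMod 4) = 0 := by decide
  have e1 := congrArg (Int.cast : ℤ → ZMod 4) h1
  have e2 := congrArg (Int.cast : ℤ → ZMod 4) h2
  push_cast at e1 e2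
  rw [hp', k4, zero_mul] at e1 e2
  have key : ∀ a b c d : ZMod 4, a ^ 2 - b ^ 2 - 3 * (c ^ 2 - d ^ 2) = 0 →
      2 * a * b - b ^ 2 - 3 * (2 * c * d - d ^ 2) = 0 →
      (2 * a = 0 ∧ 2 * b = 0) ∧ (2 * c = 0 ∧ 2 * d = 0) := by decide
  have conv : ∀ x : ℤ, (2 * (x : ZMod 4) = 0) → 2 ∣ x := by
    intro x hx
    have : ((2 * x : ℤ) : ZMod 4) = 0 := by push_cast; exact hx
    rw [ZMod.intCast_zmod_eq_zero_iff_dvd] at this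
    push_cast at this
    omega
  obtain ⟨⟨k1, k2⟩, k3, k4⟩ := key _ _ _ _ e1 e2
  exact ⟨⟨conv _ k1, conv _ k2⟩, conv _ k3, conv _ k4⟩

theorem s12_modp (p a b m n : ℤ) (hp : Prime p) (hp3 : ¬ p ∣ 3)
    (h1 : a ^ 2 - b ^ 2 = p * m) (h2 : 2 * a * b - b ^ 2 = p * n) : p ∣ a ∧ p ∣ b := by
  have h3 : p ∣ b * (2 * a - b) := ⟨n, by linarith⟩
  rcases hp.dvd_or_dvd h3 with h | h
  · refine ⟨hp.dvd_of_dvd_pow (n := 2) ?_, h⟩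
    have : a ^ 2 = p * m + b * b := by linarith
    rw [this]; exact dvd_add (dvd_mul_right _ _) (h.mul_right _)
  · obtain ⟨k, hk⟩ := h
    have hb : b = 2 * a - p * k := by linarith
    have : p ∣ 3 * a ^ 2 := ⟨4 * a * k - p * k ^ 2 - m, by
      subst hb; linear_combination -h1⟩
    have ha : p ∣ a := hp.dvd_of_dvd_pow ((hp.dvd_or_dvd this).resolve_left hp3)
    exact ⟨ha, by rw [hb]; exact dvd_sub (ha.mul_left _) (dvd_mul_right _ _)⟩

theorem s12_main (p : ℕ) (hp : p.Prime) (hp5 : 5 ≤ p) (hmod : p % 4 = 3)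
    {L : Type} [Field L] [CharZero L]
    (α β : L) (hα : α ^ 2 = (p : L)) (hβ : β ^ 2 = -3)
    (σ τ : L →+* L) (hσα : σ α = -α) (hσβ : σ β = β) (hτ : τ β = -β)
    (ζ : L) (hζ : ζ = (-1 + β) / 2)
    (a b c d : ℚ) (h : IsIntegral ℤ ((a : L) + b * β + (c + d * β) * α)) :
    ∃ k l m n : ℤ, (a : L) + b * β + (c + d * β) * α = k + l * ζ + (m + n * ζ) * α := by
  have hs := map_isIntegral_int σ h
  have e : σ ((a : L) + b * β + (c + d * β) * α) = a + b * β - (c + d * β) * α := by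
    simp [hσα, hσβ]; ring
  rw [e] at hs
  have hp0 : (p : ℚ) ≠ 0 := by exact_mod_cast hp.ne_zero
  have hαi : IsIntegral ℤ α := by
    refine IsIntegral.of_pow (n := 2) (by norm_num) ?_
    rw [hα]; exact isIntegral_natCast _
  -- U
  obtain ⟨u0, u1, hu0, hu1⟩ := s12_Q β hβ τ hτ (2 * a) (2 * b) (by
    have := h.add hs
    refine s12_conv this ?_; push_cast; ring)
  have hd := h.sub hs
  obtain ⟨w0, w1, hw0, hw1⟩ := s12_Q β hβ τ hτ (2 * p * c) (2 * p * d) (by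
    have := hd.mul hαi
    refine s12_conv this ?_; push_cast; linear_combination (-2 * c - 2 * d * β) * hα)
  obtain ⟨s0, s1, hs0, hs1⟩ := s12_Q β hβ τ hτ (4 * p * (c ^ 2 - 3 * d ^ 2)) (8 * p * c * d) (by
    have := hd.mul hd
    refine s12_conv this ?_; push_cast
    linear_combination (-4 * (c + d * β) ^ 2) * hα - 4 * p * d ^ 2 * hβ)
  have hpZ : Prime (p : ℤ) := Nat.prime_iff_prime_int.1 hp
  have hp3' : ¬ (p : ℤ) ∣ 3 := by
    intro h; have := Int.le_of_dvd (by norm_num) h; omega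
  have q1 : w1 = 4 * (p:ℚ) * d := by linarith
  have q0 : w0 = 2 * (p:ℚ) * c + 2 * p * d := by linarith
  have r1 : s1 = 16 * (p:ℚ) * c * d := by linarith
  have r0 : s0 = 4 * (p:ℚ) * (c ^ 2 - 3 * d ^ 2) + 8 * p * c * d := by linarith
  obtain ⟨⟨v0, hv0⟩, ⟨v1, hv1⟩⟩ := s12_modp p w0 w1 s0 s1 hpZ hp3' (by
      have : (w0 : ℚ) ^ 2 - w1 ^ 2 = p * s0 := by rw [q0, q1, r0]; ring
      exact_mod_cast this) (by
      have : 2 * (w0 : ℚ) * w1 - w1 ^ 2 = p * s1 := by rw [q0, q1, r1]; ring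
      exact_mod_cast this)
  have hv1' : (v1 : ℚ) = 4 * d := by
    apply mul_left_cancel₀ hp0
    have : (w1 : ℚ) = p * v1 := by exact_mod_cast hv1
    linarith
  have hv0' : (v0 : ℚ) = 2 * c + 2 * d := by
    apply mul_left_cancel₀ hp0
    have : (w0 : ℚ) = p * v0 := by exact_mod_cast hv0
    linarith
  have hu1' : (u1 : ℚ) = 4 * b := by linarith
  have hu0' : (u0 : ℚ) = 2 * a + 2 * b := by linarith
  obtain ⟨t0, t1, ht0, ht1⟩ := s12_Q β hβ τ hτ (a ^ 2 - 3 * b ^ 2 - p * (c ^ 2 - 3 * d ^ 2))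
    (2 * a * b - 2 * p * c * d) (by
    have := h.mul hs
    refine s12_conv this ?_; push_cast
    linear_combination ((c + d * β) ^ 2) * hα + (p * d ^ 2 - b ^ 2) * hβ)
  have x1 : (t1 : ℚ) = 2 * (2 * a * b - 2 * p * c * d) := by linarith
  have x0 : (t0 : ℚ) = (a ^ 2 - 3 * b ^ 2 - p * (c ^ 2 - 3 * d ^ 2)) + (2 * a * b - 2 * p * c * d) := by
    linarith
  obtain ⟨⟨⟨k, hk⟩, ⟨l, hl⟩⟩, ⟨m, hm⟩, ⟨n, hn⟩⟩ := s12_mod4 p u0 u1 v0 v1 t0 t1 (by omega) (by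
      have : (u0 : ℚ) ^ 2 - u1 ^ 2 - p * (v0 ^ 2 - v1 ^ 2) = 4 * t0 := by
        rw [hu0', hu1', hv0', hv1', x0]; ring
      exact_mod_cast this) (by
      have : 2 * (u0 : ℚ) * u1 - u1 ^ 2 - p * (2 * v0 * v1 - v1 ^ 2) = 4 * t1 := by
        rw [hu0', hu1', hv0', hv1', x1]; ring
      exact_mod_cast this)
  refine ⟨k, l, m, n, ?_⟩
  have y1 : b = l / 2 := by
    have : (u1 : ℚ) = 2 * l := by exact_mod_cast hl
    linarith
  have y0 : a = k - l / 2 := by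
    have : (u0 : ℚ) = 2 * k := by exact_mod_cast hk
    linarith
  have z1 : d = n / 2 := by
    have : (v1 : ℚ) = 2 * n := by exact_mod_cast hn
    linarith
  have z0 : c = m - n / 2 := by
    have : (v0 : ℚ) = 2 * m := by exact_mod_cast hm
    linarith
  rw [y0, y1, z0, z1, hζ]; push_cast; ring

theorem s12_span {L : Type} [Field L] [Algebra ℚ L] (p : ℕ)
    (α β : L) (hα : α ^ 2 = (p : L)) (hβ : β ^ 2 = -3)
    (x : L) (hx : x ∈ IntermediateField.adjoin ℚ ({α, β} : Set L)) :
    ∃ a b c d : ℚ, x = (a : L) + b * β + (c + d * β) * α := by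
  have : CharZero L := algebraRat.charZero L
  have hal : ∀ y ∈ ({α, β} : Set L), IsAlgebraic ℚ y := by
    rintro y (rfl | rfl)
    · refine IsIntegral.isAlgebraic (IsIntegral.of_pow (n := 2) (by norm_num) ?_)
      rw [hα]; exact isIntegral_natCast _
    · refine IsIntegral.isAlgebraic (IsIntegral.of_pow (n := 2) (by norm_num) ?_)
      rw [hβ]
      have : (-3 : L) = algebraMap ℚ L (-3) := by simp
      rw [this]; exact isIntegral_algebraMap
  rw [← IntermediateField.mem_toSubalgebra,
    IntermediateField.adjoin_toSubalgebra_of_isAlgebraic hal] at hx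
  induction hx using Algebra.adjoin_induction with
  | mem y hy =>
    rcases hy with rfl | rfl
    · exact ⟨0, 0, 1, 0, by simp⟩
    · exact ⟨0, 1, 0, 0, by simp⟩
  | algebraMap r => exact ⟨r, 0, 0, 0, by simp⟩
  | add x y _ _ h1 h2 =>
    obtain ⟨a, b, c, d, rfl⟩ := h1
    obtain ⟨a', b', c', d', rfl⟩ := h2
    exact ⟨a + a', b + b', c + c', d + d', by push_cast; ring⟩
  | mul x y _ _ h1 h2 =>
    obtain ⟨a, b, c, d, rfl⟩ := h1
    obtain ⟨a', b', c', d', rfl⟩ := h2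
    refine ⟨a * a' - 3 * b * b' + p * (c * c' - 3 * d * d'), a * b' + b * a' + p * (c * d' + d * c'),
      a * c' - 3 * b * d' + c * a' - 3 * d * b', a * d' + b * c' + c * b' + d * a', ?_⟩
    push_cast
    linear_combination ((c + d * β) * (c' + d' * β)) * hα +
      (b * b' + p * d * d' + (b * d' + d * b') * α) * hβ

theorem s12_galois {L : Type} [Field L] [Algebra ℚ L] (p : ℕ)
    (α β : L) (hα : α ^ 2 = (p : L)) (hβ : β ^ 2 = -3)
    (hL : IntermediateField.adjoin ℚ ({α, β} : Set L) = ⊤) : IsGalois ℚ L := by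
  have : CharZero L := algebraRat.charZero L
  have key : ∀ (y : L) (q : ℚ), y ^ 2 = q → IsIntegral ℚ y ∧ ((minpoly ℚ y).map (algebraMap ℚ L)).Splits := by
    intro y q hy
    have hi : IsIntegral ℚ y := by
      refine IsIntegral.of_pow (n := 2) (by norm_num) ?_
      have : (q : L) = algebraMap ℚ L q := by simp
      rw [hy, this]; exact isIntegral_algebraMap
    refine ⟨hi, ?_⟩
    have hdvd : minpoly ℚ y ∣ Polynomial.X ^ 2 - Polynomial.C q :=
      minpoly.dvd _ _ (by simp [hy])
    have hsp : ((Polynomial.X ^ 2 - Polynomial.C q : Polynomial ℚ).map (algebraMap ℚ L)).Splits := by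
      have : (Polynomial.X ^ 2 - Polynomial.C q : Polynomial ℚ).map (algebraMap ℚ L)
          = (Polynomial.X - Polynomial.C y) * (Polynomial.X + Polynomial.C y) := by
        simp only [Polynomial.map_sub, Polynomial.map_pow, Polynomial.map_X, Polynomial.map_C,
          eq_ratCast, ← hy, Polynomial.C_pow]
        ring
      rw [this]
      exact (Polynomial.Splits.X_sub_C y).mul (Polynomial.Splits.X_add_C y)
    refine hsp.of_dvd ?_ (Polynomial.map_dvd _ hdvd)
    exact Polynomial.map_ne_zero (Polynomial.X_pow_sub_C_ne_zero (by norm_num) q)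
  have hS : ∀ y ∈ ({α, β} : Set L), IsIntegral ℚ y ∧ ((minpoly ℚ y).map (algebraMap ℚ L)).Splits := by
    rintro y (rfl | rfl)
    · exact key _ p (by simpa using hα)
    · exact key _ (-3) (by simpa using hβ)
  have : Algebra.IsAlgebraic ℚ L := by
    refine ⟨fun x => ?_⟩
    have hc : ∀ q : ℚ, IsIntegral ℚ (q : L) := fun q => by
      have : (q : L) = algebraMap ℚ L q := by simp
      rw [this]; exact isIntegral_algebraMap
    have ha := (hS α (by simp)).1
    have hb := (hS β (by simp)).1
    obtain ⟨a, b, c, d, rfl⟩ := s12_span p α β hα hβ x (by rw [hL]; trivial)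
    exact (((hc a).add ((hc b).mul hb)).add (((hc c).add ((hc d).mul hb)).mul ha)).isAlgebraic
  have : Normal ℚ L := by
    refine ⟨fun x => ?_⟩
    have hx : x ∈ IntermediateField.adjoin ℚ ({α, β} : Set L) := by rw [hL]; trivial
    exact IntermediateField.splits_of_mem_adjoin _ _ hS hx
  exact ⟨⟩

theorem s12_aut {L : Type} [Field L] [Algebra ℚ L] [IsGalois ℚ L] (x y : L) (q : L) (hy : y ^ 2 = q)
    (hq : ∀ f : L →ₐ[ℚ] L, f q = q)
    (h : y ∉ IntermediateField.adjoin ℚ ({x} : Set L)) :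
    ∃ σ : L →+* L, σ y = -y ∧ σ x = x := by
  let K := IntermediateField.adjoin ℚ ({x} : Set L)
  have : IsGalois K L := inferInstance
  have : ¬ ∀ f : L ≃ₐ[K] L, f y = y := by
    intro hf
    apply h
    obtain ⟨z, hz⟩ := (InfiniteGalois.mem_range_algebraMap_iff_fixed (k := K) (K := L) y).2 hf
    rw [← hz]; exact z.2
  push Not at this
  obtain ⟨f, hf⟩ := this
  refine ⟨(f : L →+* L), ?_, ?_⟩
  · have h2 : f y ^ 2 = y ^ 2 := by
      rw [← map_pow, hy]
      exact hq ((f.toAlgHom).restrictScalars ℚ)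
    rcases sq_eq_sq_iff_eq_or_eq_neg.1 h2 with h3 | h3
    · exact absurd h3 hf
    · exact h3
  · exact f.commutes ⟨x, IntermediateField.mem_adjoin_simple_self ℚ x⟩

theorem s12_quad {L : Type} [Field L] [Algebra ℚ L] (x : L) (q : ℚ) (hx : x ^ 2 = (q : L))
    (y : L) (hy : y ∈ IntermediateField.adjoin ℚ ({x} : Set L)) : ∃ a b : ℚ, y = (a : L) + b * x := by
  have : CharZero L := algebraRat.charZero L
  have hal : ∀ y ∈ ({x} : Set L), IsAlgebraic ℚ y := by
    rintro y rfl
    refine IsIntegral.isAlgebraic (IsIntegral.of_pow (n := 2) (by norm_num) ?_)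
    have : (q : L) = algebraMap ℚ L q := by simp
    rw [hx, this]; exact isIntegral_algebraMap
  rw [← IntermediateField.mem_toSubalgebra,
    IntermediateField.adjoin_toSubalgebra_of_isAlgebraic hal] at hy
  induction hy using Algebra.adjoin_induction with
  | mem y hy =>
    rcases hy with rfl
    exact ⟨0, 1, by simp⟩
  | algebraMap r => exact ⟨r, 0, by simp⟩
  | add x y _ _ h1 h2 =>
    obtain ⟨a, b, rfl⟩ := h1
    obtain ⟨a', b', rfl⟩ := h2
    exact ⟨a + a', b + b', by push_cast; ring⟩
  | mul x y _ _ h1 h2 =>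
    obtain ⟨a, b, rfl⟩ := h1
    obtain ⟨a', b', rfl⟩ := h2
    refine ⟨a * a' + q * b * b', a * b' + b * a', ?_⟩
    push_cast
    linear_combination (b * b' : L) * hx

theorem s12_nsq (p : ℕ) (hp : p.Prime) (a : ℚ) : a ^ 2 ≠ p := by
  intro h
  have h1 : Irrational (√(p : ℝ)) := hp.irrational_sqrt
  apply h1
  refine ⟨|a|, ?_⟩
  have : (p : ℝ) = (a : ℝ) ^ 2 := by exact_mod_cast h.symm
  rw [this, Real.sqrt_sq_eq_abs]; push_cast; rfl

/-- Let `p ≥ 5` be a prime with `p ≡ 3 (mod 4)` and `p ≠ 3`, `π = √p·ζ₃` in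
`L = ℚ(√p, √-3)`, and `R_sp = ℤ[π, p·π⁻¹, π²/p]`. Then `R_sp` equals the full ring of
integers `O_L` of `L`. -/
theorem stmt12 (p : ℕ) (hp : p.Prime) (hp5 : 5 ≤ p) (hmod : p % 4 = 3) (hp3 : p ≠ 3)
    (L : Type) [Field L] [Algebra ℚ L]
    (α β : L) (hα : α ^ 2 = (p : L)) (hβ : β ^ 2 = -3)
    (hL : IntermediateField.adjoin ℚ ({α, β} : Set L) = ⊤)
    (ζ : L) (hζ : ζ = (-1 + β) / 2)
    (π : L) (hπ : π = α * ζ) :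
    Algebra.adjoin ℤ ({π, (p : L) * π⁻¹, π ^ 2 / (p : L)} : Set L) =
      integralClosure ℤ L := by
  have : CharZero L := algebraRat.charZero L
  have hp0 : (p : L) ≠ 0 := by exact_mod_cast hp.ne_zero
  have hα0 : α ≠ 0 := by rintro rfl; apply hp0; rw [← hα]; simp
  have hz2 : ζ ^ 2 = -1 - ζ := by rw [hζ]; linear_combination (1 / 4 : L) * hβ
  have hz3 : ζ ^ 3 = 1 := by linear_combination (ζ - 1) * hz2
  have hz0 : ζ ≠ 0 := by rintro rfl; simp at hz3
  have g3 : π ^ 2 / (p : L) = ζ ^ 2 := by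
    rw [hπ, mul_pow, hα]; field_simp
  have g2 : (p : L) * π⁻¹ = α * ζ ^ 2 := by
    rw [hπ, ← hα]; field_simp; exact hz3.symm
  have hαi : IsIntegral ℤ α := by
    refine IsIntegral.of_pow (n := 2) (by norm_num) ?_
    rw [hα]; exact isIntegral_natCast _
  have hζi : IsIntegral ℤ ζ := by
    refine IsIntegral.of_pow (n := 3) (by norm_num) ?_
    rw [hz3]; exact isIntegral_one
  rw [g2, g3, hπ]
  apply le_antisymm
  · rw [Algebra.adjoin_le_iff]
    rintro y (rfl | rfl | rfl)
    · exact hαi.mul hζi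
    · exact hαi.mul (hζi.pow 2)
    · exact hζi.pow 2
  · intro x hx
    have hx : IsIntegral ℤ x := hx
    have := s12_galois p α β hα hβ hL
    have hβK : β ∉ IntermediateField.adjoin ℚ ({α} : Set L) := by
      intro hmem
      obtain ⟨a, b, hab⟩ := s12_quad α p (by simpa using hα) β hmem
      have e1 : (a : L) ^ 2 + p * b ^ 2 + 3 + 2 * a * b * α = 0 := by
        rw [hab] at hβ; linear_combination hβ - (b : L) ^ 2 * hα
      have e2 : ((a ^ 2 + p * b ^ 2 + 3 : ℚ) : L) ^ 2 = ((2 * a * b : ℚ) : L) ^ 2 * p := by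
        push_cast
        linear_combination ((a : L) ^ 2 + p * b ^ 2 + 3 - 2 * a * b * α) * e1 + (2 * a * b) ^ 2 * hα
      have e3 : (a ^ 2 + p * b ^ 2 + 3) ^ 2 = (2 * a * b) ^ 2 * (p : ℚ) := by exact_mod_cast e2
      by_cases h0 : 2 * a * b = 0
      · rw [h0] at e3
        have : 0 < a ^ 2 + p * b ^ 2 + 3 := by positivity
        have := pow_pos this 2
        simp at e3; linarith
      · refine s12_nsq p hp ((a ^ 2 + p * b ^ 2 + 3) / (2 * a * b)) ?_
        rw [div_pow, e3]; exact mul_div_cancel_left₀ _ (pow_ne_zero 2 h0)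
    have hαK : α ∉ IntermediateField.adjoin ℚ ({β} : Set L) := by
      intro hmem
      obtain ⟨a, b, hab⟩ := s12_quad β (-3) (by simpa using hβ) α hmem
      have e1 : ((a ^ 2 - 3 * b ^ 2 - p : ℚ) : L) + ((2 * a * b : ℚ) : L) * β = 0 := by
        push_cast
        rw [hab] at hα; linear_combination hα - (b : L) ^ 2 * hβ
      obtain ⟨e2, e3⟩ := s12_indep β hβ _ _ e1
      have hpos : (0 : ℚ) < p := by exact_mod_cast hp.pos
      have : b = 0 := by
        by_contra hb
        have ha : a = 0 := by simpa [hb] using e3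
        subst ha
        nlinarith [sq_nonneg b]
      subst this
      exact s12_nsq p hp a (by linarith)
    obtain ⟨σ, hσα, hσβ⟩ := s12_aut β α p hα (fun f => map_natCast f p) hαK
    obtain ⟨τ, hτβ, -⟩ := s12_aut α β (-3) hβ (fun f => by simpa using map_ofNat f 3) hβK
    obtain ⟨a, b, c, d, rfl⟩ := s12_span p α β hα hβ x (by rw [hL]; trivial)
    obtain ⟨k, l, m, n, he⟩ := s12_main p hp hp5 hmod α β hα hβ σ τ hσα hσβ hτβ ζ hζ a b c d hx
    rw [he]
    set S := Algebra.adjoin ℤ ({α * ζ, α * ζ ^ 2, ζ ^ 2} : Set L) with hS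
    have m1 : α * ζ ∈ S := Algebra.subset_adjoin (by simp)
    have m3 : ζ ^ 2 ∈ S := Algebra.subset_adjoin (by simp)
    have mz : ζ ∈ S := by
      have : ζ = ζ ^ 2 * ζ ^ 2 := by linear_combination (-ζ) * hz3
      rw [this]; exact S.mul_mem m3 m3
    have ma : α ∈ S := by
      have : α = α * ζ * ζ ^ 2 := by linear_combination (-α) * hz3
      rw [this]; exact S.mul_mem m1 m3
    have mi : ∀ i : ℤ, (i : L) ∈ S := fun i => intCast_mem S i
    exact S.add_mem (S.add_mem (mi k) (S.mul_mem (mi l) mz))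
      (S.mul_mem (S.add_mem (mi m) (S.mul_mem (mi n) mz)) ma)
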